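/- arXiv:2112.02804 — 3 statements merged into one kernel-verified Lean document; each statement's English description precedes it below -/
import Mathlib

section
/- For every real x̃ with −maxF ≤ x̃ ≤ maxF, the set { y ∈ F : y ≤ x̃ } is nonempty, and its greatest element g satisfies x̃ − (|x̃|/ed + em) ≤ g ≤ x̃. -/
noncomputable section

/-- The maximum exponent `e_max = 2^(eb-1) - 1`, as an integer. -/
def emax (eb : ℕ) : ℤ := 2 ^ (eb - 1) - 1

/-- The set of finite floating-point numbers
`F = { M · 2^(e - sb + 1) : M, e ∈ ℤ, |M| ≤ 2^sb - 1, 1 - e_max ≤ e ≤ e_max }`. -/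
def Fset (eb sb : ℕ) : Set ℝ :=
  {x | ∃ M e : ℤ, |M| ≤ 2 ^ sb - 1 ∧ 1 - emax eb ≤ e ∧ e ≤ emax eb ∧
    x = (M : ℝ) * (2 : ℝ) ^ (e - (sb : ℤ) + 1)}

/-- `ed = 2^(sb-1)`. -/
def edc (sb : ℕ) : ℝ := 2 ^ (sb - 1)

/-- `em = (ed - 1) / (2^(e_max - 1) · ed)`. -/
def emc (eb sb : ℕ) : ℝ := (edc sb - 1) / ((2 : ℝ) ^ (emax eb - 1) * edc sb)

/-- The largest finite floating-point number `maxF = (2^sb - 1) · 2^(e_max - sb + 1)`. -/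
def maxF (eb sb : ℕ) : ℝ := ((2 : ℝ) ^ sb - 1) * (2 : ℝ) ^ (emax eb - (sb : ℤ) + 1)

/-- The downward rounding approximation `D(x) = x - |x|/ed - em`. -/
def Dr (eb sb : ℕ) (x : ℝ) : ℝ := x - |x| / edc sb - emc eb sb

/-- The upward rounding approximation `U(x) = x + |x|/ed + em`. -/
def Ur (eb sb : ℕ) (x : ℝ) : ℝ := x + |x| / edc sb + emc eb sb

/-- `z` is a directed rounding of `x`: the greatest element of `F` below `x`
or the least element of `F` above `x`. -/
def DirRound (eb sb : ℕ) (x z : ℝ) : Prop :=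
  IsGreatest {y ∈ Fset eb sb | y ≤ x} z ∨ IsLeast {y ∈ Fset eb sb | x ≤ y} z

lemma Fset_finite (eb sb : ℕ) : (Fset eb sb).Finite := by
  have h : ((Set.Icc (-(2 ^ sb - 1) : ℤ) (2 ^ sb - 1)) ×ˢ
      (Set.Icc (1 - emax eb) (emax eb))).Finite := (Set.finite_Icc _ _).prod (Set.finite_Icc _ _)
  refine (h.image (fun p : ℤ × ℤ => (p.1 : ℝ) * (2 : ℝ) ^ (p.2 - (sb : ℤ) + 1))).subset ?_
  rintro x ⟨M, e, hM, h1, h2, rfl⟩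
  exact ⟨(M, e), ⟨abs_le.mp hM, h1, h2⟩, rfl⟩

lemma exists_exp (L H : ℤ) (hLH : L ≤ H) (a : ℝ) (ha : a < 2 ^ (H + 1)) :
    ∃ e : ℤ, L ≤ e ∧ e ≤ H ∧ a < 2 ^ (e + 1) ∧ (e = L ∨ (2 : ℝ) ^ e ≤ a) := by
  by_cases h : a < 2 ^ (L + 1)
  · exact ⟨L, le_rfl, hLH, h, Or.inl rfl⟩
  · push Not at h
    have hpos : 0 < a := lt_of_lt_of_le (by positivity) h
    have h1 := Int.zpow_log_le_self (b := 2) (r := a) (by norm_num) hpos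
    have h2 := Int.lt_zpow_succ_log_self (b := 2) (by norm_num) a
    push_cast at h1 h2
    refine ⟨Int.log 2 a, ?_, ?_, h2, Or.inr h1⟩
    · have := (zpow_lt_zpow_iff_right₀ (by norm_num : (1 : ℝ) < 2)).mp (h.trans_lt h2)
      omega
    · have := (zpow_lt_zpow_iff_right₀ (by norm_num : (1 : ℝ) < 2)).mp (h1.trans_lt ha)
      omega

lemma exists_approx (eb sb : ℕ) (heb : 2 ≤ eb) (hsb : 2 ≤ sb)
    (x : ℝ) (hx1 : -maxF eb sb ≤ x) (hx2 : x ≤ maxF eb sb) :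
    ∃ y ∈ Fset eb sb, y ≤ x ∧ x - (|x| / edc sb + emc eb sb) ≤ y := by
  have hE : 1 ≤ emax eb := by
    have : (2 : ℤ) ^ 1 ≤ 2 ^ (eb - 1) := pow_le_pow_right₀ (by norm_num) (by omega)
    unfold emax; omega
  have hed : (2 : ℝ) ≤ edc sb := by
    have : (2 : ℝ) ^ 1 ≤ 2 ^ (sb - 1) := pow_le_pow_right₀ (by norm_num) (by omega)
    unfold edc; linarith
  have hpow : ∀ e : ℤ, (2 : ℝ) ^ sb * 2 ^ (e - (sb : ℤ) + 1) = 2 ^ (e + 1) := by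
    intro e
    rw [← zpow_natCast, ← zpow_add₀ (by norm_num)]; congr 1; ring
  have hpow' : ∀ e : ℤ, (2 : ℝ) ^ (e - (sb : ℤ) + 1) = 2 ^ e / edc sb := by
    intro e
    unfold edc
    rw [← zpow_natCast, ← zpow_sub₀ (by norm_num)]; congr 1; push_cast [Nat.cast_sub (by omega : 1 ≤ sb)]; ring
  have hem : (2 : ℝ) ^ (1 - emax eb) / edc sb ≤ emc eb sb := by
    have : emc eb sb = (edc sb - 1) * ((2 : ℝ) ^ (1 - emax eb) / edc sb) := by
      unfold emc
      rw [show 1 - emax eb = -(emax eb - 1) by ring, zpow_neg]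
      field_simp
    rw [this]
    have h0 : 0 ≤ (2 : ℝ) ^ (1 - emax eb) / edc sb := by positivity
    nlinarith
  have hem0 : 0 ≤ emc eb sb := le_trans (by positivity) hem
  have hax : |x| ≤ maxF eb sb := abs_le.mpr ⟨hx1, hx2⟩
  have hlt : |x| < 2 ^ (emax eb + 1) := by
    refine hax.trans_lt ?_
    rw [← hpow, maxF]
    have : (0 : ℝ) < 2 ^ (emax eb - (sb : ℤ) + 1) := by positivity
    nlinarith
  obtain ⟨e, he1, he2, he3, he4⟩ := exists_exp (1 - emax eb) (emax eb) (by omega) |x| hlt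
  set q : ℝ := (2 : ℝ) ^ (e - (sb : ℤ) + 1) with hq
  have hq0 : 0 < q := by positivity
  have hqb : q ≤ |x| / edc sb + emc eb sb := by
    rw [hpow' e] at hq
    rw [hq]
    rcases he4 with rfl | h
    · have : 0 ≤ |x| / edc sb := by positivity
      linarith
    · have : (2 : ℝ) ^ e / edc sb ≤ |x| / edc sb := by gcongr
      linarith
  rw [← hpow, ← hq] at he3
  obtain ⟨hl, hu⟩ := abs_lt.mp he3
  have hf1 : (⌊x / q⌋ : ℝ) * q ≤ x := (le_div_iff₀ hq0).mp (Int.floor_le _)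
  have hf2 : x < ((⌊x / q⌋ : ℝ) + 1) * q := (div_lt_iff₀ hq0).mp (Int.lt_floor_add_one _)
  refine ⟨(⌊x / q⌋ : ℝ) * q, ?_, hf1, by linarith⟩
  have hM1 : ⌊x / q⌋ < 2 ^ sb := by
    rw [Int.floor_lt]; push_cast; rwa [div_lt_iff₀ hq0]
  have hM2 : -2 ^ sb ≤ ⌊x / q⌋ := by
    rw [Int.le_floor]; push_cast; rw [le_div_iff₀ hq0]; linarith
  by_cases hM : ⌊x / q⌋ = -2 ^ sb
  · have hne : e ≠ emax eb := by
      rintro rfl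
      rw [maxF, ← hq] at hx1
      have : -(2 ^ sb - 1) ≤ ⌊x / q⌋ := by
        rw [Int.le_floor]; push_cast; rw [le_div_iff₀ hq0]; linarith
      omega
    refine ⟨-2 ^ (sb - 1), e + 1, ?_, by omega, by omega, ?_⟩
    · rw [abs_neg, abs_of_nonneg (by positivity)]
      have : (2 : ℤ) ^ (sb - 1) < 2 ^ sb := pow_lt_pow_right₀ (by norm_num) (by omega)
      omega
    · rw [hM, hpow' (e + 1)]
      push_cast
      rw [neg_mul, hq, hpow e, ← edc]
      field_simp
  · exact ⟨⌊x / q⌋, e, abs_le.mpr ⟨by omega, by omega⟩, he1, he2, rfl⟩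

theorem stmt0 (eb sb : ℕ) (heb : 2 ≤ eb) (hsb : 2 ≤ sb)
    (x : ℝ) (hx1 : -maxF eb sb ≤ x) (hx2 : x ≤ maxF eb sb) :
    {y ∈ Fset eb sb | y ≤ x}.Nonempty ∧
      ∃ g, IsGreatest {y ∈ Fset eb sb | y ≤ x} g ∧
        x - (|x| / edc sb + emc eb sb) ≤ g ∧ g ≤ x := by
  obtain ⟨y, hy, hyx, hxy⟩ := exists_approx eb sb heb hsb x hx1 hx2
  have hne : {y ∈ Fset eb sb | y ≤ x}.Nonempty := ⟨y, hy, hyx⟩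
  have hfin : {y ∈ Fset eb sb | y ≤ x}.Finite := (Fset_finite eb sb).subset (fun _ h => h.1)
  obtain ⟨g, hg, hmax⟩ := Set.exists_max_image _ id hfin hne
  exact ⟨hne, g, ⟨hg, fun z hz => hmax z hz⟩, hxy.trans (hmax y ⟨hy, hyx⟩), hg.2⟩
end
end

section
/- (Rounding enclosure, Lemma 1) Let x̃ be a real number with −maxF ≤ x̃ ≤ maxF, and let z be any directed rounding of x̃ (hence the value of x̃ rounded under an arbitrary rounding mode). Then both x̃ and z lie in the interval [D(x̃), U(x̃)], i.e., x̃ − |x̃|/ed − em ≤ z ≤ x̃ + |x̃|/ed + em and D(x̃) ≤ x̃ ≤ U(x̃). -/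
noncomputable section

theorem aux_exp (m : ℤ) (y : ℝ) (n : ℕ) (h : y ≤ (2:ℝ) ^ (m + n + 1)) :
    ∃ e : ℤ, m ≤ e ∧ e ≤ m + n ∧ y ≤ (2:ℝ) ^ (e + 1) ∧ (e = m ∨ (2:ℝ) ^ e ≤ y) := by
  induction n with
  | zero => exact ⟨m, le_refl _, by simp, by simpa using h, Or.inl rfl⟩
  | succ k ih =>
    by_cases hk : y ≤ (2:ℝ) ^ (m + k + 1)
    · obtain ⟨e, h1, h2, h3, h4⟩ := ih hk
      exact ⟨e, h1, by push_cast; omega, h3, h4⟩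
    · refine ⟨m + (k + 1 : ℕ), by omega, le_refl _, h, Or.inr ?_⟩
      push Not at hk
      have : m + ((k + 1 : ℕ) : ℤ) = m + k + 1 := by push_cast; ring
      rw [this]; exact hk.le

theorem aux_mem (eb sb : ℕ) (hsb : 2 ≤ sb) (e K : ℤ) (h1 : 1 - emax eb ≤ e)
    (h2 : e ≤ emax eb) (hK : |K| ≤ 2 ^ sb - 1 ∨ (e < emax eb ∧ |K| ≤ 2 ^ sb)) :
    (K : ℝ) * (2:ℝ) ^ (e - (sb:ℤ) + 1) ∈ Fset eb sb := by
  by_cases hs : |K| ≤ 2 ^ sb - 1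
  · exact ⟨K, e, hs, h1, h2, rfl⟩
  · rcases hK with hK | ⟨he, hK⟩
    · exact absurd hK hs
    · obtain ⟨t, rfl⟩ : ∃ t, sb = t + 1 := ⟨sb - 1, by omega⟩
      have hp : (1:ℤ) ≤ 2 ^ t := one_le_pow₀ (by norm_num)
      have hKe : |K| = 2 * 2 ^ t := by rw [pow_succ] at *; omega
      obtain ⟨M, rfl, hM⟩ : ∃ M : ℤ, K = 2 * M ∧ |M| = 2 ^ t := by
        rcases abs_cases K with ⟨h, _⟩ | ⟨h, _⟩
        · exact ⟨2 ^ t, by omega, abs_of_pos (by omega)⟩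
        · exact ⟨-2 ^ t, by omega, by rw [abs_neg]; exact abs_of_pos (by omega)⟩
      refine ⟨M, e + 1, by rw [hM, pow_succ]; omega, by omega, by omega, ?_⟩
      rw [show e + 1 - ((t + 1 : ℕ) : ℤ) + 1 = (e - ((t + 1 : ℕ) : ℤ) + 1) + 1 by ring,
        zpow_add_one₀ (by norm_num : (2:ℝ) ≠ 0) (e - ((t + 1 : ℕ) : ℤ) + 1)]
      push_cast; ring

theorem aux_edc (sb : ℕ) (hsb : 2 ≤ sb) : 2 ≤ edc sb := by
  unfold edc
  calc (2:ℝ) = 2 ^ 1 := by norm_num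
    _ ≤ 2 ^ (sb - 1) := pow_le_pow_right₀ (by norm_num) (by omega)

theorem aux_edu (sb : ℕ) (hsb : 2 ≤ sb) (e : ℤ) :
    (2:ℝ) ^ e = edc sb * (2:ℝ) ^ (e - (sb:ℤ) + 1) := by
  unfold edc
  rw [← zpow_natCast, ← zpow_add₀ (by norm_num : (2:ℝ) ≠ 0)]
  congr 1
  omega

theorem aux_em (eb sb : ℕ) (hsb : 2 ≤ sb) :
    emc eb sb = (edc sb - 1) * (2:ℝ) ^ ((1 - emax eb) - (sb:ℤ) + 1) := by
  have h := aux_edu sb hsb (1 - emax eb)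
  have hd := aux_edc sb hsb
  unfold emc
  rw [show 1 - emax eb = -(emax eb - 1) by ring, zpow_neg] at h
  rw [show 1 - emax eb = -(emax eb - 1) by ring]
  have h2 : (2:ℝ) ^ (emax eb - 1) ≠ 0 := by positivity
  have hd0 : edc sb ≠ 0 := by positivity
  rw [div_eq_mul_inv, mul_inv, h]
  field_simp

theorem aux_main (eb sb : ℕ) (heb : 2 ≤ eb) (hsb : 2 ≤ sb)
    (x : ℝ) (hx : |x| ≤ maxF eb sb) :
    ∃ a b : ℝ, a ∈ Fset eb sb ∧ b ∈ Fset eb sb ∧ a ≤ x ∧ x ≤ b ∧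
      x - a ≤ |x| / edc sb + emc eb sb ∧ b - x ≤ |x| / edc sb + emc eb sb := by
  have hd := aux_edc sb hsb
  have hE : 1 ≤ emax eb := by
    unfold emax
    have : (2:ℤ) ^ 1 ≤ 2 ^ (eb - 1) := pow_le_pow_right₀ (by norm_num) (by omega)
    omega
  have hsbu : ∀ e : ℤ, (2:ℝ) ^ (e + 1) = 2 ^ sb * (2:ℝ) ^ (e - (sb:ℤ) + 1) := by
    intro e
    rw [← zpow_natCast, ← zpow_add₀ (by norm_num : (2:ℝ) ≠ 0)]
    congr 1; ring
  have hx' : |x| ≤ (2:ℝ) ^ ((1 - emax eb) + ((2 * emax eb - 1).toNat : ℕ) + 1) := by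
    rw [show (1 - emax eb) + ((2 * emax eb - 1).toNat : ℕ) + 1 = emax eb + 1 by omega, hsbu]
    unfold maxF at hx
    have : (0:ℝ) < (2:ℝ) ^ (emax eb - (sb:ℤ) + 1) := by positivity
    linarith
  obtain ⟨e, h1, h2, h3, h4⟩ := aux_exp _ _ _ hx'
  have h2' : e ≤ emax eb := by omega
  have hu : (0:ℝ) < (2:ℝ) ^ (e - (sb:ℤ) + 1) := by positivity
  have hbd : (2:ℝ) ^ (e - (sb:ℤ) + 1) ≤ |x| / edc sb + emc eb sb := by
    have hem := aux_em eb sb hsb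
    rcases h4 with h4 | h4
    · rw [← h4] at hem
      have : 0 ≤ |x| / edc sb := by positivity
      rw [hem]; nlinarith
    · have : 0 ≤ emc eb sb := by
        rw [hem]; exact mul_nonneg (by linarith) (by positivity)
      rw [aux_edu sb hsb e] at h4
      have : (2:ℝ) ^ (e - (sb:ℤ) + 1) ≤ |x| / edc sb := by
        rw [le_div_iff₀ (by linarith)]; linarith
      linarith
  obtain ⟨N, hN, hF⟩ : ∃ N : ℤ, |x| ≤ N * (2:ℝ) ^ (e - (sb:ℤ) + 1) ∧
      ∀ K : ℤ, |K| ≤ N → (K:ℝ) * (2:ℝ) ^ (e - (sb:ℤ) + 1) ∈ Fset eb sb := by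
    rcases h2'.lt_or_eq with h | h
    · refine ⟨2 ^ sb, ?_, fun K hK => aux_mem eb sb hsb e K h1 h2' (Or.inr ⟨h, hK⟩)⟩
      push_cast; rw [← hsbu]; exact h3
    · refine ⟨2 ^ sb - 1, ?_, fun K hK => aux_mem eb sb hsb e K h1 h2' (Or.inl hK)⟩
      push_cast; rw [h]; exact hx
  set u : ℝ := (2:ℝ) ^ (e - (sb:ℤ) + 1)
  obtain ⟨hNl, hNr⟩ := abs_le.mp hN
  have hl : -(N:ℝ) ≤ x / u := by rw [le_div_iff₀ hu]; linarith
  have hr : x / u ≤ N := by rw [div_le_iff₀ hu]; linarith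
  have hxu : x / u * u = x := div_mul_cancel₀ _ hu.ne'
  have f1 := Int.floor_le (x / u)
  have f2 := Int.lt_floor_add_one (x / u)
  have c1 := Int.le_ceil (x / u)
  have c2 := Int.ceil_lt_add_one (x / u)
  refine ⟨⌊x / u⌋ * u, ⌈x / u⌉ * u, hF _ (abs_le.mpr ⟨?_, ?_⟩), hF _ (abs_le.mpr ⟨?_, ?_⟩),
    ?_, ?_, ?_, ?_⟩
  · rw [Int.le_floor]; push_cast; exact hl
  · exact_mod_cast f1.trans hr
  · exact_mod_cast hl.trans c1
  · rw [Int.ceil_le]; exact hr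
  all_goals nlinarith

theorem stmt2 (eb sb : ℕ) (heb : 2 ≤ eb) (hsb : 2 ≤ sb)
    (x z : ℝ) (hx1 : -maxF eb sb ≤ x) (hx2 : x ≤ maxF eb sb)
    (hz : DirRound eb sb x z) :
    (x - |x| / edc sb - emc eb sb ≤ z ∧ z ≤ x + |x| / edc sb + emc eb sb) ∧
      Dr eb sb x ≤ x ∧ x ≤ Ur eb sb x := by
  obtain ⟨a, b, ha, hb, hax, hxb, h1, h2⟩ := aux_main eb sb heb hsb x (abs_le.mpr ⟨hx1, hx2⟩)
  unfold Dr Ur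
  rcases hz with ⟨⟨_, hzx⟩, hg⟩ | ⟨⟨_, hzx⟩, hg⟩
  · have := hg ⟨ha, hax⟩
    refine ⟨⟨?_, ?_⟩, ?_, ?_⟩ <;> linarith
  · have := hg ⟨hb, hxb⟩
    refine ⟨⟨?_, ?_⟩, ?_, ?_⟩ <;> linarith
end
end

section
/- (Soundness of the syntactic nonemptiness condition for strong-mode interval variables) Let l and u be real numbers with −maxF ≤ l ≤ u ≤ maxF. If l ≤ u − |u|/ed − em (i.e., l ≤ D(u)), or if l + |l|/ed + em ≤ u (i.e., U(l) ≤ u), then there exists a floating-point number y ∈ F with l ≤ y ≤ u. -/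
noncomputable section

theorem core_aux (eb sb : ℕ) (hsb : 2 ≤ sb) (x : ℝ) (e : ℤ)
    (h1 : 1 - emax eb ≤ e) (h2 : e ≤ emax eb) (hx : |x| < (2 : ℝ) ^ (e + 1))
    (hl : -maxF eb sb ≤ x) :
    ∃ y ∈ Fset eb sb, y ≤ x ∧ x - y ≤ (2 : ℝ) ^ (e - (sb : ℤ) + 1) := by
  have hs : (0 : ℝ) < (2 : ℝ) ^ (e - (sb : ℤ) + 1) := by positivity
  have hpow : (2 : ℝ) ^ (e + 1) = (2 : ℝ) ^ sb * (2 : ℝ) ^ (e - (sb : ℤ) + 1) := by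
    rw [← zpow_natCast, ← zpow_add₀ (by norm_num)]
    congr 1; ring
  have hle := Int.floor_le (x / (2 : ℝ) ^ (e - (sb : ℤ) + 1))
  have hlt := Int.lt_floor_add_one (x / (2 : ℝ) ^ (e - (sb : ℤ) + 1))
  rw [le_div_iff₀ hs] at hle
  rw [div_lt_iff₀ hs] at hlt
  have hup : ⌊x / (2 : ℝ) ^ (e - (sb : ℤ) + 1)⌋ < (2 : ℤ) ^ sb := by
    rw [Int.floor_lt, div_lt_iff₀ hs]
    push_cast
    rw [← hpow]
    exact lt_of_le_of_lt (le_abs_self x) hx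
  have hlo : -(2 : ℤ) ^ sb ≤ ⌊x / (2 : ℝ) ^ (e - (sb : ℤ) + 1)⌋ := by
    rw [Int.le_floor, le_div_iff₀ hs]
    push_cast
    rw [neg_mul, ← hpow]
    linarith [neg_abs_le x]
  have hlo2 : e = emax eb → -((2 : ℤ) ^ sb - 1) ≤ ⌊x / (2 : ℝ) ^ (e - (sb : ℤ) + 1)⌋ := by
    intro he
    rw [Int.le_floor, le_div_iff₀ hs]
    push_cast
    rw [neg_mul, he]
    exact hl
  generalize ⌊x / (2 : ℝ) ^ (e - (sb : ℤ) + 1)⌋ = M at *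
  refine ⟨(M : ℝ) * (2 : ℝ) ^ (e - (sb : ℤ) + 1), ?_, hle, by linarith⟩
  by_cases hM : -((2 : ℤ) ^ sb - 1) ≤ M
  · exact ⟨M, e, abs_le.2 ⟨hM, by omega⟩, h1, h2, rfl⟩
  · have hMe : M = -(2 : ℤ) ^ sb := by omega
    have hne : e ≠ emax eb := fun h => hM (hlo2 h)
    obtain ⟨k, rfl⟩ : ∃ k, sb = k + 1 := ⟨sb - 1, by omega⟩
    have hk : (0 : ℤ) < 2 ^ k := by positivity
    refine ⟨-(2 : ℤ) ^ k, e + 1, ?_, by omega, by omega, ?_⟩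
    · rw [abs_neg, abs_of_pos hk, pow_succ]; omega
    · rw [hMe, show e + 1 - ((k + 1 : ℕ) : ℤ) + 1 = (e - ((k + 1 : ℕ) : ℤ) + 1) + 1 by ring]
      generalize e - ((k + 1 : ℕ) : ℤ) + 1 = t
      rw [zpow_add_one₀ (by norm_num : (2 : ℝ) ≠ 0)]
      push_cast
      ring

theorem down_aux (eb sb : ℕ) (heb : 2 ≤ eb) (hsb : 2 ≤ sb) (x : ℝ)
    (hl : -maxF eb sb ≤ x) (hu : x ≤ maxF eb sb) :
    ∃ y ∈ Fset eb sb, x - |x| / edc sb - emc eb sb ≤ y ∧ y ≤ x := by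
  have hem : 1 ≤ emax eb := by
    have : (2 : ℤ) ^ 1 ≤ 2 ^ (eb - 1) := pow_le_pow_right₀ (by norm_num) (by omega)
    unfold emax; omega
  have hed : (2 : ℝ) ≤ edc sb := by
    have : (2 : ℝ) ^ 1 ≤ 2 ^ (sb - 1) := pow_le_pow_right₀ (by norm_num) (by omega)
    unfold edc; linarith
  have hsp : ∀ e : ℤ, (2 : ℝ) ^ (e - (sb : ℤ) + 1) = (2 : ℝ) ^ e / edc sb := by
    intro e
    unfold edc
    rw [← zpow_natCast, ← zpow_sub₀ (by norm_num)]
    congr 1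
    have : ((sb - 1 : ℕ) : ℤ) = (sb : ℤ) - 1 := by omega
    rw [this]; ring
  have hemc : emc eb sb = (edc sb - 1) * ((2 : ℝ) ^ (1 - emax eb) / edc sb) := by
    unfold emc
    rw [show 1 - emax eb = -(emax eb - 1) by ring, zpow_neg]
    field_simp
  have heta : 0 < (2 : ℝ) ^ (1 - emax eb) / edc sb := by positivity
  have hemge : (2 : ℝ) ^ (1 - emax eb) / edc sb ≤ emc eb sb := by
    rw [hemc]; nlinarith
  have hdiv : 0 ≤ |x| / edc sb := by positivity
  by_cases hx : |x| < (2 : ℝ) ^ (1 - emax eb)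
  · obtain ⟨y, hy, h1, h2⟩ := core_aux eb sb hsb x (1 - emax eb) le_rfl (by omega)
      (hx.trans (zpow_lt_zpow_right₀ (by norm_num) (by omega))) hl
    rw [hsp] at h2
    exact ⟨y, hy, by linarith, h1⟩
  · push Not at hx
    have hpos : 0 < |x| := lt_of_lt_of_le (by positivity) hx
    have hb1 : (2 : ℝ) ^ (Int.log 2 |x|) ≤ |x| := by
      exact_mod_cast Int.zpow_log_le_self (b := 2) (by norm_num) hpos
    have hb2 : |x| < (2 : ℝ) ^ (Int.log 2 |x| + 1) := by
      exact_mod_cast Int.lt_zpow_succ_log_self (b := 2) (by norm_num) |x|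
    have hmax : maxF eb sb < (2 : ℝ) ^ (emax eb + 1) := by
      have : (2 : ℝ) ^ (emax eb + 1) = (2 : ℝ) ^ sb * (2 : ℝ) ^ (emax eb - (sb : ℤ) + 1) := by
        rw [← zpow_natCast, ← zpow_add₀ (by norm_num)]
        congr 1; ring
      rw [this]; unfold maxF
      have : (0 : ℝ) < (2 : ℝ) ^ (emax eb - (sb : ℤ) + 1) := by positivity
      linarith
    have habs : |x| ≤ maxF eb sb := abs_le.2 ⟨hl, hu⟩
    have e1 : 1 - emax eb < Int.log 2 |x| + 1 :=
      (zpow_lt_zpow_iff_right₀ (by norm_num : (1 : ℝ) < 2)).1 (hx.trans_lt hb2)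
    have e2 : Int.log 2 |x| < emax eb + 1 :=
      (zpow_lt_zpow_iff_right₀ (by norm_num : (1 : ℝ) < 2)).1
        ((hb1.trans habs).trans_lt hmax)
    obtain ⟨y, hy, h1, h2⟩ := core_aux eb sb hsb x (Int.log 2 |x|) (by omega) (by omega) hb2 hl
    rw [hsp] at h2
    have h3 : (2 : ℝ) ^ (Int.log 2 |x|) / edc sb ≤ |x| / edc sb := by gcongr
    exact ⟨y, hy, by linarith, h1⟩

theorem stmt10 (eb sb : ℕ) (heb : 2 ≤ eb) (hsb : 2 ≤ sb)
    (l u : ℝ) (hl : -maxF eb sb ≤ l) (hlu : l ≤ u) (hu : u ≤ maxF eb sb)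
    (h : l ≤ u - |u| / edc sb - emc eb sb ∨ l + |l| / edc sb + emc eb sb ≤ u) :
    ∃ y ∈ Fset eb sb, l ≤ y ∧ y ≤ u := by
  rcases h with h | h
  · obtain ⟨y, hy, h1, h2⟩ := down_aux eb sb heb hsb u (hl.trans hlu) hu
    exact ⟨y, hy, h.trans h1, h2⟩
  · obtain ⟨y, ⟨M, e, hM, he1, he2, rfl⟩, h1, h2⟩ :=
      down_aux eb sb heb hsb (-l) (by linarith) (by linarith)
    rw [abs_neg] at h1
    refine ⟨-((M : ℝ) * (2 : ℝ) ^ (e - (sb : ℤ) + 1)),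
      ⟨-M, e, by rwa [abs_neg], he1, he2, by push_cast; ring⟩, by linarith, by linarith⟩
end
end
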